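/- Correlatively sparse measure reformulation of fractional programming: let p₁,…,p_t, q₁,…,q_t, g₁,…,g_m ∈ ℝ[x₁,…,xₙ] and X = {x ∈ ℝⁿ : g₁(x) ≥ 0, …, g_m(x) ≥ 0}, assumed nonempty. Assume: (i) there are sets I₁,…,I_t ⊆ {1,…,n} covering {1,…,n} with pᵢ, qᵢ ∈ ℝ[x,Iᵢ] for every i; (ii) {1,…,m} is partitioned into J₁,…,J_t with g_j ∈ ℝ[x,Iᵢ] for every j ∈ Jᵢ; (iii) I₁,…,I_t satisfy the running intersection property; (iv) for every i there exist Nᵢ > 0 and j ∈ Jᵢ with g_j = Nᵢ − Σ_{k∈Iᵢ} x_k². For each i set Xᵢ = {y ∈ ℝ^{Iᵢ} : g_j(y) ≥ 0 for all j ∈ Jᵢ} and suppose qᵢ(y) > 0 for all y ∈ Xᵢ. Then the infimum, over all tuples (μ₁,…,μ_t) of finite Borel measures with μᵢ a measure on ℝ^{Iᵢ} vanishing outside Xᵢ, satisfying ∫ qᵢ dμᵢ = 1 for every i and, for every pair i,j with Iᵢ ∩ I_j ≠ ∅, the pushforward under coordinate restriction to ℝ^{Iᵢ∩I_j} of the measure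 with density qᵢ with respect to μᵢ equals the pushforward of the measure with density q_j with respect to μ_j, of Σ_{i=1}^t ∫ pᵢ dμᵢ, equals the minimum over x ∈ X of Σ_{i=1}^t pᵢ(x)/qᵢ(x). -/

import Mathlib

open MeasureTheory MvPolynomial

/-- The running intersection property for a family of finite sets `I 0, …, I (p-1)`:
for every `k < p - 1` there is `l ≤ k` with `I (k+1) ∩ (I 0 ∪ ⋯ ∪ I k) ⊆ I l`. -/
def RIPFinset {α : Type*} [DecidableEq α] {p : ℕ} (I : Fin p → Finset α) : Prop :=
  ∀ (k : ℕ) (hk : k + 1 < p),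
    ∃ l : Fin p, (l : ℕ) ≤ k ∧
      I ⟨k + 1, hk⟩ ∩ (Finset.univ.filter (fun j : Fin p => (j : ℕ) ≤ k)).biUnion I ⊆ I l

/-- Extension by zero of a point of `ℝ^s` to a point of `ℝⁿ`; composing with it identifies a
polynomial in the variables of `s` with a polynomial function on `ℝ^s`. -/
def extZero {n : ℕ} (s : Finset (Fin n)) (y : {i // i ∈ s} → ℝ) : Fin n → ℝ :=
  fun i => if h : i ∈ s then y ⟨i, h⟩ else 0

open ProbabilityTheory in
/-- Gluing of two measures along a common marginal. -/
theorem exists_measure_glue {Ω Z S : Type*} [MeasurableSpace Ω] [MeasurableSpace Z]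
    [StandardBorelSpace Z] [Nonempty Z] [MeasurableSpace S]
    (μ : Measure Ω) (σ : Measure Z) [IsFiniteMeasure μ] [IsFiniteMeasure σ]
    {f : Ω → S} {g : Z → S} (hf : Measurable f) (hg : Measurable g)
    (h : μ.map f = σ.map g) :
    ∃ ρ : Measure (Ω × Z), ρ.map Prod.fst = μ ∧
      ρ.map (Prod.map f id) = σ.map (fun z => (g z, z)) := by
  have hgid : Measurable fun z => (g z, z) := hg.prodMk measurable_id
  set τ : Measure (S × Z) := σ.map (fun z => (g z, z)) with hτ
  have hfst : τ.fst = μ.map f := by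
    rw [h, Measure.fst, hτ, Measure.map_map measurable_fst hgid]
    rfl
  refine ⟨μ ⊗ₘ (τ.condKernel.comap f hf), Measure.fst_compProd _ _, ?_⟩
  refine Eq.trans ?_ (τ.disintegrate τ.condKernel)
  rw [hfst]
  ext s hs
  rw [Measure.map_apply (hf.prodMap measurable_id) hs,
    Measure.compProd_apply (hf.prodMap measurable_id hs), Measure.compProd_apply hs,
    lintegral_map (Kernel.measurable_kernel_prodMk_left hs) hf]
  rfl

/-- Probability measures on coordinate spaces satisfying the running intersection property,
with consistent overlapping marginals, have a common extension. -/
theorem exists_common_extension_of_RIPFinset {α : Type*} [Fintype α] [DecidableEq α] {t : ℕ}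
    {I : Fin t → Finset α} (hI : RIPFinset I)
    (ν : ∀ i, Measure ({l // l ∈ I i} → ℝ)) [∀ i, IsProbabilityMeasure (ν i)]
    (hν : ∀ i j : Fin t, (I i ∩ I j).Nonempty →
      (ν i).map (fun y (l : {l // l ∈ I i ∩ I j}) => y ⟨l.1, (Finset.mem_inter.mp l.2).1⟩) =
      (ν j).map (fun y (l : {l // l ∈ I i ∩ I j}) => y ⟨l.1, (Finset.mem_inter.mp l.2).2⟩)) :
    ∃ ρ : Measure (α → ℝ), IsProbabilityMeasure ρ ∧
      ∀ i, ρ.map (fun x (l : {l // l ∈ I i}) => x l.1) = ν i := by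
  suffices H : ∀ k ≤ t, ∃ ρ : Measure (α → ℝ), IsProbabilityMeasure ρ ∧
      ∀ i : Fin t, (i : ℕ) < k → ρ.map (fun x (l : {l // l ∈ I i}) => x l.1) = ν i by
    obtain ⟨ρ, h1, h2⟩ := H t le_rfl
    exact ⟨ρ, h1, fun i => h2 i i.2⟩
  intro k
  induction k with
  | zero => exact fun _ => ⟨Measure.dirac 0, inferInstance, fun i hi => absurd hi (by omega)⟩
  | succ k ih =>
    intro hk
    obtain ⟨ρ, hρ, hρν⟩ := ih (by omega)
    set c : Fin t := ⟨k, hk⟩ with hc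
    obtain ⟨T, hTc, hTcover, hT⟩ : ∃ (T : Finset α) (hTc : T ⊆ I c),
        (∀ i : Fin t, (i : ℕ) < k → I i ∩ I c ⊆ T) ∧
        ρ.map (fun x (l : {l // l ∈ T}) => x l.1) =
          (ν c).map (fun y (l : {l // l ∈ T}) => y ⟨l.1, hTc l.2⟩) := by
      have hempty : ρ.map (fun x (l : {l // l ∈ (∅ : Finset α)}) => x l.1) =
          (ν c).map (fun y (l : {l // l ∈ (∅ : Finset α)}) =>
            y ⟨l.1, Finset.empty_subset _ l.2⟩) := by
        ext s hs
        rw [Measure.map_apply (by fun_prop) hs, Measure.map_apply (by fun_prop) hs]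
        rcases s.eq_empty_or_nonempty with rfl | hne
        · simp
        · simp [Subsingleton.eq_univ_of_nonempty hne]
      rcases Nat.eq_zero_or_pos k with h0 | h0
      · exact ⟨∅, Finset.empty_subset _, fun i hi => absurd hi (by omega), hempty⟩
      · obtain ⟨l, hl, hsub⟩ := hI (k - 1) (by omega)
        have hce : (⟨k - 1 + 1, by omega⟩ : Fin t) = c := Fin.ext (by simp [hc]; omega)
        rw [hce] at hsub
        have hcov : ∀ i : Fin t, (i : ℕ) < k → I i ∩ I c ⊆ I l ∩ I c := by
          intro i hi a ha
          rw [Finset.mem_inter] at ha ⊢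
          refine ⟨hsub (Finset.mem_inter.2 ⟨ha.2, Finset.mem_biUnion.2 ⟨i, ?_, ha.1⟩⟩), ha.2⟩
          exact Finset.mem_filter.2 ⟨Finset.mem_univ _, by omega⟩
        rcases Finset.eq_empty_or_nonempty (I l ∩ I c) with he | hne
        · exact ⟨∅, Finset.empty_subset _, fun i hi => he ▸ hcov i hi, hempty⟩
        · refine ⟨I l ∩ I c, Finset.inter_subset_right, hcov, ?_⟩
          rw [← hν l c hne, ← hρν l (by omega), Measure.map_map (by fun_prop) (by fun_prop)]
          rfl
    obtain ⟨θ, hθ1, hθ2⟩ := exists_measure_glue ρ (ν c) (by fun_prop) (by fun_prop) hT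
    have hθsnd : θ.map Prod.snd = ν c := by
      have := congrArg (Measure.map Prod.snd) hθ2
      rw [Measure.map_map measurable_snd (by fun_prop),
        Measure.map_map measurable_snd (by fun_prop)] at this
      exact this.trans Measure.map_id
    have hae : ∀ᵐ w ∂θ, ∀ l : {l // l ∈ T}, w.1 l.1 = w.2 ⟨l.1, hTc l.2⟩ := by
      have hset : MeasurableSet {u : ({l // l ∈ T} → ℝ) × ({l // l ∈ I c} → ℝ) |
          u.1 = fun l => u.2 ⟨l.1, hTc l.2⟩} :=
        measurableSet_eq_fun (by fun_prop) (by fun_prop)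
      have h1 : ∀ᵐ u ∂((ν c).map fun y => ((fun l : {l // l ∈ T} => y ⟨l.1, hTc l.2⟩), y)),
          u.1 = fun l => u.2 ⟨l.1, hTc l.2⟩ :=
        (ae_map_iff (by fun_prop) hset).2 (by simp)
      rw [← hθ2] at h1
      filter_upwards [(ae_map_iff (by fun_prop) hset).1 h1] with w hw l
      exact congrFun hw l
    have hm : Measurable fun (w : (α → ℝ) × ({l // l ∈ I c} → ℝ)) (a : α) =>
        if h : a ∈ I c then w.2 ⟨a, h⟩ else w.1 a := by
      refine measurable_pi_lambda _ fun a => ?_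
      by_cases h : a ∈ I c
      · simp only [h, dite_true]; fun_prop
      · simp only [h, dite_false]; fun_prop
    have hθp : IsProbabilityMeasure θ := by
      rw [← hθ1] at hρ
      exact Measure.isProbabilityMeasure_of_map Prod.fst
    refine ⟨θ.map _, Measure.isProbabilityMeasure_map hm.aemeasurable, fun i hi => ?_⟩
    rw [Measure.map_map (by fun_prop) hm]
    rcases Nat.lt_succ_iff_lt_or_eq.1 hi with hi | hi
    · rw [← hρν i hi, ← hθ1, Measure.map_map (by fun_prop) measurable_fst]
      refine Measure.map_congr ?_
      filter_upwards [hae] with w hw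
      funext l
      by_cases h : l.1 ∈ I c
      · simpa [h] using (hw ⟨l.1, hTcover i hi (Finset.mem_inter.2 ⟨l.2, h⟩)⟩).symm
      · simp [h]
    · obtain rfl : i = c := Fin.ext hi
      rw [← hθsnd]
      congr 1
      funext w l
      simp [l.2]

theorem MvPolynomial.eval_congr_of_mem_supported {σ R : Type*} [CommSemiring R] {s : Set σ}
    {p : MvPolynomial σ R} (hp : p ∈ supported R s) {x y : σ → R} (h : ∀ i ∈ s, x i = y i) :
    eval x p = eval y p := by
  refine eval₂Hom_congr' rfl (fun i hi _ => h i ?_) rfl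
  exact (mem_supported.1 hp) hi

theorem eval_extZero_restrict {n : ℕ} {s : Finset (Fin n)} {p : MvPolynomial (Fin n) ℝ}
    (hp : p ∈ supported ℝ (s : Set (Fin n))) (x : Fin n → ℝ) :
    eval (extZero s fun l => x l.1) p = eval x p :=
  eval_congr_of_mem_supported hp fun i hi => by simp [extZero, Finset.mem_coe.1 hi]

theorem measurable_extZero {n : ℕ} (s : Finset (Fin n)) : Measurable (extZero s) := by
  refine measurable_pi_lambda _ fun a => ?_
  unfold extZero
  by_cases h : a ∈ s
  · simp only [h, dite_true]; fun_prop
  · simp only [h, dite_false]; fun_prop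

theorem measurable_eval_extZero {n : ℕ} (s : Finset (Fin n)) (p : MvPolynomial (Fin n) ℝ) :
    Measurable fun y => eval (extZero s y) p :=
  (continuous_eval p).measurable.comp (measurable_extZero s)

/-- A basic closed set whose coordinates are all controlled by ball constraints is compact. -/
theorem isCompact_of_ball_constraints {n m t : ℕ} (g : Fin m → MvPolynomial (Fin n) ℝ)
    (I : Fin t → Finset (Fin n)) (hcover : ∀ i : Fin n, ∃ k, i ∈ I k)
    (hball : ∀ i, ∃ (N : ℝ) (j : Fin m), g j = C N - ∑ l ∈ I i, X l ^ 2) :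
    IsCompact {x : Fin n → ℝ | ∀ j, 0 ≤ eval x (g j)} := by
  choose k hk using hcover
  choose N j hj using hball
  refine (isCompact_univ_pi fun l : Fin n =>
    isCompact_Icc (a := -(N (k l) + 1)) (b := N (k l) + 1)).of_isClosed_subset ?_ ?_
  · simp only [Set.ofPred_forall]
    exact isClosed_iInter fun j => isClosed_le continuous_const (continuous_eval _)
  · intro x hx l _
    have h1 := hx (j (k l))
    rw [hj] at h1
    simp only [map_sub, eval_C, map_sum, map_pow, eval_X] at h1
    have h2 := Finset.single_le_sum (f := fun l => x l ^ 2) (fun i _ => sq_nonneg _) (hk l)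
    constructor <;> nlinarith

theorem withDensity_smul_dirac_inv {α : Type*} [MeasurableSpace α] {h : α → ℝ}
    (hm : Measurable h) {a : α} (ha : 0 < h a) :
    (ENNReal.ofReal (h a)⁻¹ • Measure.dirac a).withDensity (fun y => ENNReal.ofReal (h y)) =
      Measure.dirac a := by
  classical
  ext s hs
  rw [withDensity_apply _ hs, Measure.restrict_smul, lintegral_smul_measure,
    setLIntegral_dirac' hm.ennreal_ofReal hs, Measure.dirac_apply' _ hs, Set.indicator_apply]
  split_ifs with h
  · rw [smul_eq_mul, ← ENNReal.ofReal_mul (inv_nonneg.2 ha.le), inv_mul_cancel₀ ha.ne']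
    simp
  · simp

theorem isProbabilityMeasure_withDensity_ofReal {α : Type*} [MeasurableSpace α]
    {μ : Measure α} {h : α → ℝ} (hpos : 0 ≤ᵐ[μ] h) (h1 : ∫ y, h y ∂μ = 1) :
    IsProbabilityMeasure (μ.withDensity fun y => ENNReal.ofReal (h y)) := by
  have hintegrable : Integrable h μ := by
    by_contra hn
    exact zero_ne_one ((integral_undef hn).symm.trans h1)
  refine ⟨?_⟩
  rw [withDensity_apply _ MeasurableSet.univ, Measure.restrict_univ,
    ← ofReal_integral_eq_lintegral_ofReal hintegrable hpos, h1, ENNReal.ofReal_one]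

theorem integral_div_withDensity_ofReal {α : Type*} [MeasurableSpace α] {μ : Measure α}
    {h : α → ℝ} (hm : Measurable h) (hpos : ∀ᵐ y ∂μ, 0 < h y) (p : α → ℝ) :
    ∫ y, p y / h y ∂(μ.withDensity fun y => ENNReal.ofReal (h y)) = ∫ y, p y ∂μ := by
  rw [integral_withDensity_eq_integral_toReal_smul hm.ennreal_ofReal
    (Filter.Eventually.of_forall fun _ => ENNReal.ofReal_lt_top)]
  refine integral_congr_ae ?_
  filter_upwards [hpos] with y hy
  rw [ENNReal.toReal_ofReal hy.le, smul_eq_mul, mul_div_cancel₀ _ hy.ne']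

/-- **Correlatively sparse measure reformulation of fractional programming**: under the
correlative sparsity assumptions with running intersection property and ball constraints, the
infimum of `Σᵢ ∫ pᵢ dμᵢ` over tuples of finite measures `μᵢ` supported on `Xᵢ`, normalized by
`∫ qᵢ dμᵢ = 1` and with consistent overlapping marginals of the measures `qᵢ dμᵢ`, equals the
minimum of `Σᵢ pᵢ/qᵢ` on `X`. -/
theorem cs_fractional_programming_measure_reformulation (n m t : ℕ)
    (P Q : Fin t → MvPolynomial (Fin n) ℝ)
    (g : Fin m → MvPolynomial (Fin n) ℝ)
    (K : Set (Fin n → ℝ)) (hK : K = {x | ∀ j, 0 ≤ eval x (g j)}) (hKne : K.Nonempty)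
    (I : Fin t → Finset (Fin n)) (hcover : ∀ i : Fin n, ∃ k, i ∈ I k)
    (hPsupp : ∀ i, P i ∈ MvPolynomial.supported ℝ ((I i : Finset (Fin n)) : Set (Fin n)))
    (hQsupp : ∀ i, Q i ∈ MvPolynomial.supported ℝ ((I i : Finset (Fin n)) : Set (Fin n)))
    (J : Fin t → Finset (Fin m))
    (hJdisj : ∀ k l, k ≠ l → Disjoint (J k) (J l))
    (hJcover : ∀ j : Fin m, ∃ k, j ∈ J k)
    (hgsupp : ∀ i, ∀ j ∈ J i,
      g j ∈ MvPolynomial.supported ℝ ((I i : Finset (Fin n)) : Set (Fin n)))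
    (hRIP : RIPFinset I)
    (hball : ∀ i, ∃ N : ℝ, 0 < N ∧ ∃ j ∈ J i, g j = C N - ∑ l ∈ I i, X l ^ 2)
    (hQpos : ∀ i : Fin t, ∀ y : {l // l ∈ I i} → ℝ,
      (∀ j ∈ J i, 0 ≤ eval (extZero (I i) y) (g j)) → 0 < eval (extZero (I i) y) (Q i)) :
    sInf {v : ℝ | ∃ μ : ∀ i : Fin t, Measure ({l // l ∈ I i} → ℝ),
        (∀ i, IsFiniteMeasure (μ i)) ∧
        (∀ i, μ i ({y : {l // l ∈ I i} → ℝ |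
            ∀ j ∈ J i, 0 ≤ eval (extZero (I i) y) (g j)}ᶜ) = 0) ∧
        (∀ i, (∫ y, eval (extZero (I i) y) (Q i) ∂(μ i)) = 1) ∧
        (∀ i j : Fin t, (I i ∩ I j).Nonempty →
          Measure.map
              (fun (y : {l // l ∈ I i} → ℝ) (l : {l // l ∈ I i ∩ I j}) =>
                y ⟨l.1, (Finset.mem_inter.mp l.2).1⟩)
              ((μ i).withDensity fun y => ENNReal.ofReal (eval (extZero (I i) y) (Q i))) =
            Measure.map
              (fun (y : {l // l ∈ I j} → ℝ) (l : {l // l ∈ I i ∩ I j}) =>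
                y ⟨l.1, (Finset.mem_inter.mp l.2).2⟩)
              ((μ j).withDensity fun y => ENNReal.ofReal (eval (extZero (I j) y) (Q j)))) ∧
        v = ∑ i, ∫ y, eval (extZero (I i) y) (P i) ∂(μ i)} =
      sInf {v : ℝ | ∃ x ∈ K, v = ∑ i, eval x (P i) / eval x (Q i)} := by
  have hmem : ∀ x, x ∈ K ↔ ∀ i, ∀ j ∈ J i, 0 ≤ eval (extZero (I i) fun l => x l.1) (g j) := by
    intro x
    rw [hK]
    refine ⟨fun h i j hj => ?_, fun h j => ?_⟩
    · rw [eval_extZero_restrict (hgsupp i j hj)]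
      exact h j
    · obtain ⟨k, hk⟩ := hJcover j
      have := h k j hk
      rwa [eval_extZero_restrict (hgsupp k j hk)] at this
  have hKc : IsCompact K := hK ▸ isCompact_of_ball_constraints g I hcover fun i => by
    obtain ⟨N, -, j, -, h⟩ := hball i
    exact ⟨N, j, h⟩
  have hQK : ∀ i, ∀ x ∈ K, 0 < eval x (Q i) := fun i x hx => by
    rw [← eval_extZero_restrict (hQsupp i)]
    exact hQpos i _ ((hmem x).1 hx i)
  have hcont : ∀ i, ContinuousOn (fun x => eval x (P i) / eval x (Q i)) K := fun i =>
    (continuous_eval _).continuousOn.div (continuous_eval _).continuousOn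
      fun x hx => (hQK i x hx).ne'
  let f : (Fin n → ℝ) → ℝ := fun x => ∑ i, eval x (P i) / eval x (Q i)
  have hfcont : ContinuousOn f K := continuousOn_finsetSum _ fun i _ => hcont i
  have hbdd : BddBelow {v : ℝ | ∃ x ∈ K, v = f x} := by
    obtain ⟨b, hb⟩ := hKc.bddBelow_image hfcont
    refine ⟨b, ?_⟩
    rintro _ ⟨x, hx, rfl⟩
    exact hb ⟨x, hx, rfl⟩
  have hne : {v : ℝ | ∃ x ∈ K, v = f x}.Nonempty := hKne.imp' f fun x hx => ⟨x, hx, rfl⟩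
  have sInf_eq : ∀ {A B : Set ℝ}, B.Nonempty → B ⊆ A → (∀ a ∈ A, sInf B ≤ a) →
      sInf A = sInf B := fun hB hBA hA =>
    le_antisymm (csInf_le_csInf ⟨_, hA⟩ hB hBA) (le_csInf (hB.mono hBA) hA)
  refine sInf_eq hne ?_ ?_
  · rintro _ ⟨x, hx, rfl⟩
    refine ⟨fun i => ENNReal.ofReal (eval x (Q i))⁻¹ • Measure.dirac fun l => x l.1,
      fun i => Measure.smul_finite _ ENNReal.ofReal_ne_top, fun i => ?_, fun i => ?_,
      fun i j _ => ?_, ?_⟩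
    · have hd : (Measure.dirac fun l : {l // l ∈ I i} => x l.1) {y : {l // l ∈ I i} → ℝ |
            ∀ j ∈ J i, 0 ≤ eval (extZero (I i) y) (g j)}ᶜ = 0 := by
        rw [← mem_ae_iff]
        have hs : MeasurableSet {y : {l // l ∈ I i} → ℝ |
            ∀ j ∈ J i, 0 ≤ eval (extZero (I i) y) (g j)} := by
          simp only [Set.ofPred_forall]
          exact MeasurableSet.iInter fun j => MeasurableSet.iInter fun _ =>
            measurableSet_le measurable_const (measurable_eval_extZero _ _)
        exact (ae_dirac_iff hs).2 ((hmem x).1 hx i)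
      simp [hd]
    · rw [integral_smul_measure, integral_dirac, eval_extZero_restrict (hQsupp i),
        ENNReal.toReal_ofReal (inv_nonneg.2 (hQK i x hx).le), smul_eq_mul,
        inv_mul_cancel₀ (hQK i x hx).ne']
    · have key : ∀ i, (ENNReal.ofReal (eval x (Q i))⁻¹ •
          Measure.dirac fun l : {l // l ∈ I i} => x l.1).withDensity
            (fun y => ENNReal.ofReal (eval (extZero (I i) y) (Q i))) =
          Measure.dirac fun l : {l // l ∈ I i} => x l.1 := by
        intro i
        have := withDensity_smul_dirac_inv (measurable_eval_extZero (I i) (Q i))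
          (a := fun l => x l.1) (by rw [eval_extZero_restrict (hQsupp i)]; exact hQK i x hx)
        rwa [eval_extZero_restrict (hQsupp i)] at this
      rw [key, key, Measure.map_dirac' (by fun_prop), Measure.map_dirac' (by fun_prop)]
    · refine Finset.sum_congr rfl fun i _ => ?_
      rw [integral_smul_measure, integral_dirac, eval_extZero_restrict (hPsupp i),
        ENNReal.toReal_ofReal (inv_nonneg.2 (hQK i x hx).le), smul_eq_mul]
      ring
  · rintro _ ⟨μ, hμfin, hμsupp, hμQ, hμcons, rfl⟩
    let ν := fun i => (μ i).withDensity
      fun y => ENNReal.ofReal (eval (extZero (I i) y) (Q i))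
    have hμae : ∀ i, ∀ᵐ y ∂(μ i), ∀ j ∈ J i, 0 ≤ eval (extZero (I i) y) (g j) := hμsupp
    have hμpos : ∀ i, ∀ᵐ y ∂(μ i), 0 < eval (extZero (I i) y) (Q i) := fun i =>
      (hμae i).mono (hQpos i)
    have hνprob : ∀ i, IsProbabilityMeasure (ν i) := fun i =>
      isProbabilityMeasure_withDensity_ofReal ((hμpos i).mono fun _ h => h.le) (hμQ i)
    obtain ⟨ρ, hρ, hρν⟩ := exists_common_extension_of_RIPFinset hRIP ν hμcons
    have hρK : ∀ᵐ x ∂ρ, x ∈ K := by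
      have hall : ∀ i, ∀ᵐ x ∂ρ, ∀ j ∈ J i,
          0 ≤ eval (extZero (I i) fun l => x l.1) (g j) := fun i => by
        have hi : ∀ᵐ y ∂(ν i), ∀ j ∈ J i, 0 ≤ eval (extZero (I i) y) (g j) :=
          (withDensity_absolutelyContinuous _ _).ae_le (hμae i)
        rw [← hρν i] at hi
        exact ae_of_ae_map (Measurable.aemeasurable (by fun_prop)) hi
      filter_upwards [ae_all_iff.2 hall] with x hx
      exact (hmem x).2 hx
    have hρres : ρ.restrict K = ρ := Measure.restrict_eq_self_of_ae_mem hρK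
    have hPQ : ∀ i, ∫ y, eval (extZero (I i) y) (P i) ∂(μ i) =
        ∫ x, eval x (P i) / eval x (Q i) ∂ρ := by
      intro i
      have hm : Measurable fun y => eval (extZero (I i) y) (P i) / eval (extZero (I i) y) (Q i) :=
        (measurable_eval_extZero _ _).div (measurable_eval_extZero _ _)
      rw [← integral_div_withDensity_ofReal (measurable_eval_extZero (I i) (Q i)) (hμpos i),
        show (μ i).withDensity _ = _ from (hρν i).symm,
        integral_map (Measurable.aemeasurable (by fun_prop)) hm.aestronglyMeasurable]
      simp only [eval_extZero_restrict (hPsupp i), eval_extZero_restrict (hQsupp i)]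
    have hintegrable : ∀ i, Integrable (fun x => eval x (P i) / eval x (Q i)) ρ := fun i => by
      rw [← hρres]
      exact (hcont i).integrableOn_compact hKc
    rw [Finset.sum_congr rfl fun i _ => hPQ i, ← integral_finsetSum _ fun i _ => hintegrable i]
    refine le_trans ?_ (integral_mono_ae (integrable_const (sInf {v : ℝ | ∃ x ∈ K, v = f x}))
      (integrable_finsetSum _ fun i _ => hintegrable i) ?_)
    · rw [integral_const, probReal_univ, one_smul]
    · filter_upwards [hρK] with x hx
      exact csInf_le hbdd ⟨x, hx, rfl⟩
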